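/- arXiv:1506.04879 — 5 statements merged into one kernel-verified Lean document; each statement's English description precedes it below -/
import Mathlib

section
/- For every finite set of interactions γ, every interaction α, and every history-clock valuation h : A → ℝ, if ℰ(γ)(h) holds then ℰ(γ ⊖ α)(h) holds. -/
variable {A : Type*} [DecidableEq A]

/-- The set of actions involved in a set of interactions. -/
def Act (γ : Finset (Finset A)) : Finset A := γ.sup id

/-- `γ ⊖ α`: eliminate from every interaction of `γ` the actions of `α`. -/
def ominus (γ : Finset (Finset A)) (α : Finset A) : Finset (Finset A) :=
  (γ.filter (fun β => ¬ β ⊆ α)).image (fun β => β \ α)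

lemma ominus_card_lt {γ : Finset (Finset A)} {α : Finset A} (hα : α ∈ γ) :
    (ominus γ α).card < γ.card := by
  calc (ominus γ α).card ≤ (γ.filter (fun β => ¬ β ⊆ α)).card := Finset.card_image_le
    _ ≤ (γ.erase α).card := Finset.card_le_card (by
        intro β hβ
        rw [Finset.mem_filter] at hβ
        exact Finset.mem_erase.mpr ⟨fun h => hβ.2 (h ▸ Finset.Subset.refl α), hβ.1⟩)
    _ < γ.card := Finset.card_erase_lt_of_mem hα

/-- The interaction inequalities `ℰ(γ)` on history clocks. -/
def IE (γ : Finset (Finset A)) (h : A → ℝ) : Prop :=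
  γ = ∅ ∨ ∃ α, ∃ _ : α ∈ γ,
    (∀ ai ∈ α, ∀ aj ∈ α, h ai = h aj) ∧
    (∀ ai ∈ α, ∀ ak ∈ Act (ominus γ α), h ai ≤ h ak) ∧
    IE (ominus γ α) h
termination_by γ.card
decreasing_by exact ominus_card_lt (by assumption)

lemma mem_ominus_iff (γ : Finset (Finset A)) (α x : Finset A) :
    x ∈ ominus γ α ↔ ∃ b ∈ γ, ¬ b ⊆ α ∧ b \ α = x := by
  simp [ominus, and_assoc]

lemma ominus_ominus (γ : Finset (Finset A)) (α β : Finset A) :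
    ominus (ominus γ α) β = ominus γ (α ∪ β) := by
  ext x
  simp only [mem_ominus_iff]
  constructor
  · rintro ⟨_, ⟨b, hb, h1, rfl⟩, h2, rfl⟩
    refine ⟨b, hb, fun h => h2 (sdiff_le_iff.mpr h), ?_⟩
    ext a; simp; tauto
  · rintro ⟨b, hb, h1, rfl⟩
    refine ⟨b \ α, ⟨b, hb, fun h => h1 (h.trans Finset.subset_union_left), rfl⟩,
      fun h => h1 (sdiff_le_iff.mp h), ?_⟩
    ext a; simp; tauto

lemma Act_ominus_subset (γ : Finset (Finset A)) (α : Finset A) :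
    Act (ominus γ α) ⊆ Act γ := by
  intro a ha
  simp only [Act, Finset.mem_sup, id, mem_ominus_iff] at ha ⊢
  obtain ⟨_, ⟨b, hb, _, rfl⟩, hab⟩ := ha
  exact ⟨b, hb, (Finset.mem_sdiff.mp hab).1⟩

lemma IE_ominus_aux (α : Finset A) (h : A → ℝ) (n : ℕ) :
    ∀ γ : Finset (Finset A), γ.card = n → IE γ h → IE (ominus γ α) h := by
  induction n using Nat.strong_induction_on with
  | _ n ih =>
    intro γ hn hE
    rw [IE] at hE
    rcases hE with rfl | ⟨β, hβ, heq, hle, hE⟩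
    · rw [IE]; left; simp [ominus]
    · have key := ih _ (hn ▸ ominus_card_lt hβ) (ominus γ β) rfl hE
      by_cases hs : β ⊆ α
      · rwa [ominus_ominus, Finset.union_eq_right.mpr hs] at key
      · have e : ominus (ominus γ α) (β \ α) = ominus (ominus γ β) α := by
          rw [ominus_ominus, ominus_ominus, Finset.union_sdiff_self_eq_union, Finset.union_comm]
        rw [IE]
        right
        refine ⟨β \ α, (mem_ominus_iff _ _ _).mpr ⟨β, hβ, hs, rfl⟩, ?_, ?_, ?_⟩
        · intro a ha b hb
          exact heq a (Finset.mem_sdiff.mp ha).1 b (Finset.mem_sdiff.mp hb).1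
        · intro a ha b hb
          rw [e] at hb
          exact hle a (Finset.mem_sdiff.mp ha).1 b (Act_ominus_subset _ _ hb)
        · rwa [e]

/-- if ℰ(γ)(h) holds then ℰ(γ ⊖ α)(h) holds. -/
theorem IE_ominus (γ : Finset (Finset A)) (hγ : ∀ β ∈ γ, β.Nonempty)
    (α : Finset A) (hα : α.Nonempty) (h : A → ℝ) (hE : IE γ h) :
    IE (ominus γ α) h := by
  exact IE_ominus_aux α h _ γ rfl hE
end

section
/- If γ is a finite set of pairwise disjoint interactions (for all α₁, α₂ ∈ γ with α₁ ≠ α₂, α₁ ∩ α₂ = ∅), then for every history-clock valuation h : A → ℝ, ℰ(γ)(h) holds if and only if for every α ∈ γ and every pair of actions a_i, a_j ∈ α one has h a_i = h a_j. -/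
variable {A : Type*} [DecidableEq A]

/-- For pairwise disjoint nonempty interactions, `γ ⊖ α` just removes `α`. -/
lemma ominus_eq_erase {γ : Finset (Finset A)} {α : Finset A}
    (hγ : ∀ β ∈ γ, β.Nonempty)
    (hdisj : ∀ α₁ ∈ γ, ∀ α₂ ∈ γ, α₁ ≠ α₂ → α₁ ∩ α₂ = ∅) (hα : α ∈ γ) :
    ominus γ α = γ.erase α := by
  have key : ∀ β ∈ γ, β ≠ α → β \ α = β ∧ ¬ β ⊆ α := by
    intro β hβ hne
    have hd := hdisj β hβ α hα hne
    refine ⟨Finset.sdiff_eq_self_of_disjoint (Finset.disjoint_iff_inter_eq_empty.mpr hd), ?_⟩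
    intro hsub
    rw [Finset.inter_eq_left.mpr hsub] at hd
    exact (hγ β hβ).ne_empty hd
  ext δ
  simp only [ominus, Finset.mem_image, Finset.mem_filter, Finset.mem_erase]
  constructor
  · rintro ⟨β, ⟨hβ, hs⟩, rfl⟩
    have hne : β ≠ α := by
      rintro rfl
      exact hs (Finset.Subset.refl _)
    rw [(key β hβ hne).1]
    exact ⟨hne, hβ⟩
  · rintro ⟨hne, hδ⟩
    exact ⟨δ, ⟨hδ, (key δ hδ hne).2⟩, (key δ hδ hne).1⟩

/-- for pairwise disjoint interactions, ℰ(γ) reduces to the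
conjunction of equalities of the history clocks within each interaction. -/
theorem IE_of_pairwise_disjoint (γ : Finset (Finset A))
    (hγ : ∀ β ∈ γ, β.Nonempty)
    (hdisj : ∀ α₁ ∈ γ, ∀ α₂ ∈ γ, α₁ ≠ α₂ → α₁ ∩ α₂ = ∅) (h : A → ℝ) :
    IE γ h ↔ ∀ α ∈ γ, ∀ ai ∈ α, ∀ aj ∈ α, h ai = h aj := by
  induction hn : γ.card using Nat.strong_induction_on generalizing γ with
  | _ n ih =>
  subst hn
  have step : ∀ α ∈ γ, (IE (ominus γ α) h ↔
      ∀ β ∈ γ.erase α, ∀ ai ∈ β, ∀ aj ∈ β, h ai = h aj) := by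
    intro α hα
    rw [ominus_eq_erase hγ hdisj hα]
    exact ih _ (Finset.card_erase_lt_of_mem hα) _
      (fun β hβ => hγ β (Finset.mem_of_mem_erase hβ))
      (fun a ha b hb => hdisj a (Finset.mem_of_mem_erase ha) b (Finset.mem_of_mem_erase hb)) rfl
  rw [IE]
  constructor
  · rintro (rfl | ⟨α, hα, heq, -, hr⟩)
    · simp
    · intro β hβ
      by_cases hne : β = α
      · subst hne
        exact heq
      · exact (step α hα).1 hr β (Finset.mem_erase.mpr ⟨hne, hβ⟩)
  · intro H
    rcases γ.eq_empty_or_nonempty with he | hne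
    · exact Or.inl he
    right
    have hA : (Act γ).Nonempty := by
      obtain ⟨α, hα⟩ := hne
      obtain ⟨a, ha⟩ := hγ α hα
      exact ⟨a, Finset.mem_sup.mpr ⟨α, hα, ha⟩⟩
    obtain ⟨m, hm, hmin⟩ := Finset.exists_min_image (Act γ) h hA
    obtain ⟨α, hα, hmα⟩ := Finset.mem_sup.mp hm
    refine ⟨α, hα, H α hα, ?_, (step α hα).2
      (fun β hβ => H β (Finset.mem_of_mem_erase hβ))⟩
    intro ai hai ak hak
    rw [ominus_eq_erase hγ hdisj hα] at hak
    obtain ⟨β, hβ, hk⟩ := Finset.mem_sup.mp hak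
    rw [H α hα ai hai m hmα]
    exact hmin ak (Finset.mem_sup.mpr ⟨β, Finset.mem_of_mem_erase hβ, hk⟩)
end

section
/- Let γ be a finite set of interactions, h : A → ℝ, and H : Finset A → ℝ with H α ≥ 0 for every α ∈ γ. Suppose ℰ*(γ)(h, H) holds, i.e., for every a ∈ Act(γ), h a = min { H α | α ∈ γ, a ∈ α }. Let β ∈ γ and define h' by h' a = 0 if a ∈ β and h' a = h a otherwise, and H' by H' β = 0 and H' α = H α for α ≠ β. Then ℰ*(γ)(h', H') holds. (This is the discrete-step case in the proof that ℰ* is an inductive predicate of the system extended with interaction history clocks.) -/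
variable {A : Type*} [DecidableEq A]

lemma filter_mem_nonempty {γ : Finset (Finset A)} {a : A} (ha : a ∈ Act γ) :
    (γ.filter (fun α => a ∈ α)).Nonempty := by
  obtain ⟨α, hαγ, hαa⟩ := Finset.mem_sup.mp ha
  exact ⟨α, Finset.mem_filter.mpr ⟨hαγ, hαa⟩⟩

/-- `ℰ*(γ)(h, H)`: every action history clock `h a`, for `a ∈ Act(γ)`, equals
the minimum of the history clocks `H α` of the interactions `α ∈ γ`
containing `a`. -/
def EStar (γ : Finset (Finset A)) (h : A → ℝ) (H : Finset A → ℝ) : Prop :=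
  ∀ (a : A) (ha : a ∈ Act γ),
    h a = ((γ.filter (fun α => a ∈ α)).image H).min'
            ((filter_mem_nonempty ha).image H)

/-- ℰ* is preserved when an interaction β ∈ γ executes, i.e.,
when the history clocks of β and of all its actions are reset to 0
(discrete-step case of inductiveness). -/
theorem EStar_reset (γ : Finset (Finset A)) (hγ : ∀ β ∈ γ, β.Nonempty)
    (h : A → ℝ) (H : Finset A → ℝ) (hH : ∀ α ∈ γ, H α ≥ 0)
    (hE : EStar γ h H) (β : Finset A) (hβ : β ∈ γ) :
    EStar γ (fun a => if a ∈ β then 0 else h a)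
      (fun α => if α = β then 0 else H α) := by
  intro a ha
  by_cases hab : a ∈ β
  · simp only [hab, if_true]
    apply le_antisymm
    · apply Finset.le_min'
      intro y hy
      obtain ⟨α, hα, rfl⟩ := Finset.mem_image.mp hy
      have := hH α (Finset.mem_filter.mp hα).1
      split_ifs
      · exact le_rfl
      · exact this
    · apply Finset.min'_le
      exact Finset.mem_image.mpr ⟨β, Finset.mem_filter.mpr ⟨hβ, hab⟩, by simp⟩
  · simp only [hab, if_false]
    rw [hE a ha]
    congr 1
    apply Finset.image_congr
    intro α hα
    have hα' := (Finset.mem_filter.mp (Finset.mem_coe.mp hα)).2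
    have hne : α ≠ β := by
      rintro rfl
      exact hab hα'
    simp [hne]
end

section
/- Let (S', init', step') and (S, init, step) be transition systems and f : S' → S a map such that: (i) for all s', t' ∈ S', step' s' t' implies step (f s') (f t'); (ii) for all s' ∈ S' and t ∈ S, step (f s') t implies there exists t' ∈ S' with step' s' t' and f t' = t. Let Ψ ⊆ S' be inductive for step' (if s' ∈ Ψ and step' s' t' then t' ∈ Ψ) and suppose f '' (init' ∩ Ψ) = init. Then for every invariant Φ' of (S', init', step'), the image f '' (Φ' ∩ Ψ) is an invariant of (S, init, step). (This generalizes the argument by which the conjunction of an invariant of the history-clock extension with an inductive assertion on history clocks yields, after projection, an invariant of the original system.) -/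
/-- The set of reachable states of a transition system. -/
def Reach {S : Type*} (init : Set S) (step : S → S → Prop) : Set S :=
  {t | ∃ s ∈ init, Relation.ReflTransGen step s t}

/-- combining an invariant of the primed system with an
inductive set `Ψ` and projecting through `f` yields an invariant of the
unprimed system. -/
theorem image_inter_inductive_invariant {S' S : Type*}
    (init' : Set S') (step' : S' → S' → Prop)
    (init : Set S) (step : S → S → Prop) (f : S' → S)
    (hsim : ∀ s' t' : S', step' s' t' → step (f s') (f t'))
    (hlift : ∀ (s' : S') (t : S), step (f s') t →
      ∃ t' : S', step' s' t' ∧ f t' = t)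
    (Ψ : Set S') (hΨ : ∀ s' t' : S', s' ∈ Ψ → step' s' t' → t' ∈ Ψ)
    (hinit : f '' (init' ∩ Ψ) = init) :
    ∀ Φ' : Set S', Reach init' step' ⊆ Φ' →
      Reach init step ⊆ f '' (Φ' ∩ Ψ) := by
  intro Φ' hΦ t ht
  obtain ⟨s, hs, hst⟩ := ht
  have key : ∃ t' : S', t' ∈ Reach init' step' ∧ t' ∈ Ψ ∧ f t' = t := by
    induction hst with
    | refl =>
      rw [← hinit] at hs
      obtain ⟨s', ⟨h1, h2⟩, h3⟩ := hs
      exact ⟨s', ⟨s', h1, Relation.ReflTransGen.refl⟩, h2, h3⟩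
    | tail _ hstep ih =>
      obtain ⟨u', ⟨s', h1, h2⟩, h3, h4⟩ := ih
      rw [← h4] at hstep
      obtain ⟨t', h5, h6⟩ := hlift _ _ hstep
      exact ⟨t', ⟨s', h1, h2.tail h5⟩, hΨ _ _ h3 h5, h6⟩
  obtain ⟨t', h1, h2, h3⟩ := key
  exact ⟨t', ⟨hΦ h1, h2⟩, h3⟩
end

section
/- For every regular expression E over an alphabet α with decidable equality and every symbol a ∈ α, the language of the elimination E ∖ a equals the image of the language of E under the map erasing all occurrences of a: matches' (E ∖ a) = { w.filter (· ≠ a) | w ∈ matches' E }. (This is the semantic content of the last-occurrence-retention rule E·a ⟶ (E ∖ a)·a used to abstract regular expressions.) -/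
open RegularExpression

variable {α : Type*} [DecidableEq α]

/-- The syntactic elimination operator `E ∖ a`, erasing the symbol `a` from
the regular expression `E`. -/
def elim : RegularExpression α → α → RegularExpression α
  | zero, _ => zero
  | epsilon, _ => epsilon
  | char x, a => if x = a then epsilon else char x
  | plus p q, a => plus (elim p a) (elim q a)
  | comp p q, a => comp (elim p a) (elim q a)
  | RegularExpression.star p, a => RegularExpression.star (elim p a)

theorem mem_matches'_elim (E : RegularExpression α) (a : α) : ∀ x : List α,
    x ∈ (elim E a).matches' ↔ ∃ w, w ∈ E.matches' ∧ w.filter (· ≠ a) = x := by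
  induction E with
  | zero =>
    intro x
    change x ∈ (0 : Language α) ↔ ∃ w, w ∈ (0 : Language α) ∧ _
    simp [Language.notMem_zero]
  | epsilon =>
    intro x
    change x ∈ (1 : Language α) ↔ ∃ w, w ∈ (1 : Language α) ∧ _
    simp [Language.mem_one, eq_comm]
  | char c =>
    intro x
    have hc : ∀ (d : α) (y : List α), y ∈ (char d).matches' ↔ y = [d] := fun _ _ => Iff.rfl
    have h1 : ∀ y : List α, y ∈ (epsilon : RegularExpression α).matches' ↔ y = [] :=
      fun y => Language.mem_one y
    by_cases h : c = a
    · simp only [elim, if_pos h, h1, hc, exists_eq_left]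
      rw [eq_comm]
      simp [h]
    · simp only [elim, if_neg h, hc, exists_eq_left]
      rw [eq_comm]
      simp [h]
  | plus p q ihp ihq =>
    intro x
    change x ∈ (elim p a).matches' + (elim q a).matches' ↔
      ∃ w, w ∈ p.matches' + q.matches' ∧ _
    simp only [Language.mem_add, ihp, ihq, or_and_right, exists_or]
  | comp p q ihp ihq =>
    intro x
    change x ∈ (elim p a).matches' * (elim q a).matches' ↔
      ∃ w, w ∈ p.matches' * q.matches' ∧ _
    simp only [Language.mem_mul, ihp, ihq]
    constructor
    · rintro ⟨_, ⟨u, hu, rfl⟩, _, ⟨v, hv, rfl⟩, rfl⟩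
      exact ⟨u ++ v, ⟨u, hu, v, hv, rfl⟩, List.filter_append ..⟩
    · rintro ⟨_, ⟨u, hu, v, hv, rfl⟩, rfl⟩
      exact ⟨_, ⟨u, hu, rfl⟩, _, ⟨v, hv, rfl⟩, (List.filter_append ..).symm⟩
  | star p ih =>
    intro x
    change x ∈ KStar.kstar (elim p a).matches' ↔ ∃ w, w ∈ KStar.kstar p.matches' ∧ _
    simp only [Language.mem_kstar, ih]
    constructor
    · rintro ⟨L, rfl, hL⟩
      induction L with
      | nil => exact ⟨[], ⟨[], rfl, by simp⟩, rfl⟩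
      | cons y L ihL =>
        obtain ⟨_, ⟨M, rfl, hM⟩, h⟩ := ihL fun y hy => hL y (List.mem_cons_of_mem _ hy)
        obtain ⟨u, hu, hy⟩ := hL y List.mem_cons_self
        refine ⟨_, ⟨u :: M, rfl, ?_⟩, ?_⟩
        · intro z hz
          rcases List.mem_cons.1 hz with rfl | hz
          · exact hu
          · exact hM z hz
        · rw [List.flatten_cons, List.filter_append, h, hy, List.flatten_cons]
    · rintro ⟨_, ⟨M, rfl, hM⟩, rfl⟩
      refine ⟨M.map (List.filter (· ≠ a)), List.filter_flatten .., ?_⟩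
      intro y hy
      obtain ⟨u, hu, rfl⟩ := List.mem_map.1 hy
      exact ⟨u, hM u hu, rfl⟩

/-- the language of `E ∖ a` is the image of the language of `E`
under the map erasing all occurrences of `a`. -/
theorem matches'_elim (E : RegularExpression α) (a : α) :
    (elim E a).matches' = (fun w : List α => w.filter (· ≠ a)) '' E.matches' := by
  ext x
  exact mem_matches'_elim E a x
end
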